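/- arXiv:1207.2303 — 4 statements merged into one kernel-verified Lean document; each statement's English description precedes it below -/
import Mathlib

section
/- Let φ : [0,∞) → [0,∞) be continuously differentiable with φ(0) = 0, suppose the map t ↦ φ(t²) is strictly convex on [0,∞), and suppose there exist s and μ with 0 < μ < 1 such that φ'(t)·t ≤ (sμ/2)·φ(t) for all t ≥ 0. Then for every t > 0 one has φ(t) < 2·φ'(t)·t ≤ sμ·φ(t), and consequently sμ > 1. -/
open Set

/-- if `φ` is `C¹` on `[0,∞)` with `φ(0)=0`, `t ↦ φ(t²)` strictly convex on
`[0,∞)`, and `φ'(t) t ≤ (sμ/2) φ(t)` for all `t ≥ 0` with `0 < μ < 1`, then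
`φ(t) < 2 φ'(t) t ≤ sμ φ(t)` for all `t > 0`, and consequently `sμ > 1`. -/
theorem phi_deriv_bounds (φ : ℝ → ℝ) (s μ : ℝ)
    (hφmap : ∀ t ≥ (0 : ℝ), 0 ≤ φ t)
    (hφC1 : ContDiffOn ℝ 1 φ (Ici 0))
    (hφ0 : φ 0 = 0)
    (hconv : StrictConvexOn ℝ (Ici 0) (fun t => φ (t ^ 2)))
    (hμ0 : 0 < μ) (hμ1 : μ < 1)
    (hineq : ∀ t ≥ (0 : ℝ), deriv φ t * t ≤ s * μ / 2 * φ t) :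
    (∀ t : ℝ, 0 < t → φ t < 2 * deriv φ t * t ∧ 2 * deriv φ t * t ≤ s * μ * φ t) ∧
      1 < s * μ := by
  have key : ∀ t : ℝ, 0 < t → φ t < 2 * deriv φ t * t := by
    intro t ht
    have hd : HasDerivAt φ (deriv φ t) (√t ^ 2) := by
      rw [Real.sq_sqrt ht.le]
      exact ((hφC1.differentiableOn one_ne_zero).differentiableAt
        (Ici_mem_nhds ht)).hasDerivAt
    have hx : 0 < √t := Real.sqrt_pos.2 ht
    have hg : HasDerivAt (fun x => φ (x ^ 2)) (deriv φ t * (2 * √t)) √t := by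
      simpa [Function.comp_def] using HasDerivAt.comp (h := fun x : ℝ => x ^ 2) √t hd (hasDerivAt_pow 2 √t)
    have h := StrictConvexOn.slope_lt_of_hasDerivAt hconv self_mem_Ici hx.le hx hg
    simp only [slope_def_field, sub_zero, ne_eq, OfNat.ofNat_ne_zero, not_false_eq_true,
      zero_pow, hφ0, Real.sq_sqrt ht.le] at h
    rw [div_lt_iff₀ hx] at h
    calc φ t < deriv φ t * (2 * √t) * √t := h
      _ = 2 * deriv φ t * √t ^ 2 := by ring
      _ = 2 * deriv φ t * t := by rw [Real.sq_sqrt ht.le]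
  refine ⟨fun t ht => ⟨key t ht, by linarith [hineq t ht.le]⟩, ?_⟩
  nlinarith [key 1 one_pos, hineq 1 zero_le_one, hφmap 1 zero_le_one]
end

section
/- Let 1 < p < q and define φ(t) = (2/p)·[(1 + t^{q/2})^{p/q} − 1] for t ≥ 0. Then 2·φ'(t)·t ≤ q·φ(t) for all t ≥ 0, where φ'(t) = t^{q/2−1}·(1 + t^{q/2})^{p/q−1} is the derivative of φ for t > 0. -/
/-- The tangent line of the concave function `x ↦ x ^ r` at `1 + s`, evaluated at `1`. -/
theorem mul_mul_one_add_rpow_sub_one_le {r s : ℝ} (hr0 : 0 ≤ r) (hr1 : r ≤ 1) (hs : 0 ≤ s) :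
    r * s * (1 + s) ^ (r - 1) ≤ (1 + s) ^ r - 1 := by
  have hx : 0 < 1 + s := by linarith
  have hinv : 1 + (-(s / (1 + s))) = (1 + s)⁻¹ := by
    field_simp
    ring
  have hbern : (1 + (-(s / (1 + s)))) ^ r ≤ 1 + r * (-(s / (1 + s))) :=
    rpow_one_add_le_one_add_mul_self (by linarith [inv_pos.mpr hx]) hr0 hr1
  rw [hinv, Real.inv_rpow hx.le] at hbern
  have hpos : 0 < (1 + s) ^ r := Real.rpow_pos_of_pos hx r
  have hmul := mul_le_mul_of_nonneg_left hbern hpos.le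
  rw [mul_inv_cancel₀ hpos.ne'] at hmul
  rw [Real.rpow_sub_one hx.ne']
  have hcomm : r * s * ((1 + s) ^ r / (1 + s)) = (1 + s) ^ r * (r * (s / (1 + s))) := by ring
  linarith

/-- for `φ(t) = (2/p)[(1 + t^{q/2})^{p/q} − 1]` with `1 < p < q` and
`φ'(t) = t^{q/2−1} (1 + t^{q/2})^{p/q−1}`, one has `2 φ'(t) t ≤ q φ(t)` for all `t ≥ 0`. -/
theorem phi_example_deriv_bound (p q : ℝ) (hp : 1 < p) (hpq : p < q) :
    ∀ t : ℝ, 0 ≤ t →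
      2 * (t ^ (q / 2 - 1) * (1 + t ^ (q / 2)) ^ (p / q - 1)) * t ≤
        q * (2 / p * ((1 + t ^ (q / 2)) ^ (p / q) - 1)) := by
  intro t ht
  have hp0 : 0 < p := by linarith
  have hq0 : 0 < q := by linarith
  rcases ht.eq_or_lt with rfl | ht
  · simp [Real.zero_rpow (half_pos hq0).ne']
  · have key := mul_mul_one_add_rpow_sub_one_le (div_nonneg hp0.le hq0.le)
      ((div_le_one hq0).mpr hpq.le) (Real.rpow_nonneg ht.le (q / 2))
    rw [Real.rpow_sub_one ht.ne']
    calc 2 * (t ^ (q / 2) / t * (1 + t ^ (q / 2)) ^ (p / q - 1)) * t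
        = 2 * q / p * (p / q * t ^ (q / 2) * (1 + t ^ (q / 2)) ^ (p / q - 1)) := by
          field_simp
      _ ≤ 2 * q / p * ((1 + t ^ (q / 2)) ^ (p / q) - 1) := by gcongr
      _ = q * (2 / p * ((1 + t ^ (q / 2)) ^ (p / q) - 1)) := by ring
end

section
/- Let 1 < p < q and define φ(t) = (2/p)·[(1 + t^{q/2})^{p/q} − 1] for t ≥ 0. Then the map t ↦ φ(t²) = (2/p)·[(1 + t^{q})^{p/q} − 1] is strictly convex on [0,∞). -/
open Set

/-- The `ℓ^q` norm of `(1, t)` is a convex function of `t ≥ 0`. -/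
theorem convexOn_one_add_rpow_rpow_inv {q : ℝ} (hq : 1 ≤ q) :
    ConvexOn ℝ (Ici (0 : ℝ)) fun t : ℝ => (1 + t ^ q) ^ (1 / q) := by
  have hq0 : q ≠ 0 := by linarith
  have scale (a x : ℝ) (ha : 0 ≤ a) (hx : 0 ≤ x) :
      (a ^ q + (a * x) ^ q) ^ (1 / q) = a * (1 + x ^ q) ^ (1 / q) := by
    rw [Real.mul_rpow ha hx, ← mul_one_add, Real.mul_rpow (by positivity) (by positivity),
      one_div, Real.rpow_rpow_inv ha hq0]
  refine ⟨convex_Ici 0, fun x hx y hy a b ha hb hab => ?_⟩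
  rw [mem_Ici] at hx hy
  have minkowski := Real.Lp_add_le_of_nonneg (s := Finset.univ) (f := ![a, a * x])
    (g := ![b, b * y]) hq
    (by simp [Fin.forall_fin_two, ha, mul_nonneg ha hx])
    (by simp [Fin.forall_fin_two, hb, mul_nonneg hb hy])
  simpa [Fin.sum_univ_two, hab, scale, ← one_div, ha, hb, hx, hy] using minkowski

/-- for `1 < p < q`, the map `t ↦ (2/p)[(1 + t^q)^{p/q} − 1]` is strictly
convex on `[0,∞)`. -/
theorem phi_example_strictConvex (p q : ℝ) (hp : 1 < p) (hpq : p < q) :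
    StrictConvexOn ℝ (Ici (0 : ℝ))
      (fun t : ℝ => 2 / p * ((1 + t ^ q) ^ (p / q) - 1)) := by
  have hp0 : 0 < p := by linarith
  have hq0 : 0 < q := by linarith
  have key : StrictConvexOn ℝ (Ici (0 : ℝ)) fun t : ℝ => (1 + t ^ q) ^ (p / q) := by
    have hconv := convexOn_one_add_rpow_rpow_inv (hp.trans hpq).le
    have himage : (fun t : ℝ => (1 + t ^ q) ^ (1 / q)) '' Ici 0 ⊆ Ici 0 := by
      rintro _ ⟨t, ht, rfl⟩
      rw [mem_Ici] at ht ⊢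
      positivity
    have hcont : ContinuousOn (fun t : ℝ => (1 + t ^ q) ^ (1 / q)) (Ici 0) := by
      have : Continuous fun t : ℝ => (1 + t ^ q) ^ (1 / q) :=
        (continuous_const.add (Real.continuous_rpow_const hq0.le)).rpow_const
          fun _ => Or.inr (by positivity)
      exact this.continuousOn
    have himage_convex := (isPreconnected_Ici.image _ hcont).convex
    have hinj : InjOn (fun t : ℝ => (1 + t ^ q) ^ (1 / q)) (Ici 0) := by
      intro x hx y hy hxy
      rw [mem_Ici] at hx hy
      have h := (Real.rpow_left_inj (by positivity) (by positivity) (by positivity)).1 hxy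
      exact (Real.rpow_left_inj hx hy hq0.ne').1 (add_left_cancel h)
    refine (((strictConvexOn_rpow hp).subset himage himage_convex).comp_convexOn hconv
      ((Real.strictMonoOn_rpow_Ici_of_exponent_pos hp0).mono himage).monotoneOn hinj).congr
      fun t ht => ?_
    rw [mem_Ici] at ht
    simp only [Function.comp_apply]
    rw [← Real.rpow_mul (by positivity), one_div_mul_eq_div]
  refine ⟨convex_Ici 0, fun x hx y hy hxy a b ha hb hab => ?_⟩
  have h := mul_lt_mul_of_pos_left (key.2 hx hy hxy ha hb hab) (show 0 < 2 / p by positivity)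
  simp only [smul_eq_mul] at h ⊢
  linear_combination h + 2 / p * hab
end

section
/- Let N ≥ 2, 1 < p < q, 1 < α, and max{q, α} < s. Let φ : [0,∞) → [0,∞) be continuous and suppose there is C > 0 with φ(t) ≤ C·t^{p/2} for t ≥ 1 and φ(t) ≤ C·t^{q/2} for 0 ≤ t ≤ 1. Then for every u ∈ C_c^∞(ℝ^N, ℝ) with u not identically zero there exists T > 0 such that for all t ≥ T: (1/2)·∫_{ℝ^N} φ(|t∇u|²) + (1/α)·∫_{ℝ^N} |t·u|^α − (1/s)·∫_{ℝ^N} |t·u|^s < 0. -/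
open MeasureTheory Set

section NegativeForLargeT

open Filter Topology

lemma HasCompactSupport.integrable_norm_rpow {X E : Type*} [TopologicalSpace X]
    [MeasurableSpace X] [OpensMeasurableSpace X] {μ : Measure X} [IsFiniteMeasureOnCompacts μ]
    [NormedAddCommGroup E] {f : X → E} (hf : Continuous f) (hsupp : HasCompactSupport f)
    {r : ℝ} (hr : 0 < r) : Integrable (fun x => ‖f x‖ ^ r) μ :=
  (hf.norm.rpow_const fun _ => Or.inr hr.le).integrable_of_hasCompactSupport
    (hsupp.comp_left (g := fun y => ‖y‖ ^ r) (by simp [hr.ne']))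

/-- No integrability of `f` is needed: a non-integrable `f` has integral `0`. -/
lemma integral_le_of_le_of_integrable_of_nonneg {X : Type*} [MeasurableSpace X] {μ : Measure X}
    {f g : X → ℝ} (hg : Integrable g μ) (hg0 : ∀ x, 0 ≤ g x) (hfg : ∀ x, f x ≤ g x) :
    ∫ x, f x ∂μ ≤ ∫ x, g x ∂μ := by
  by_cases hf : Integrable f μ
  · exact integral_mono hf hg hfg
  · rw [integral_undef hf]
    exact integral_nonneg hg0

lemma apply_sq_le_of_growth {φ : ℝ → ℝ} {C p q : ℝ} (hC : 0 < C)
    (h1 : ∀ t : ℝ, 1 ≤ t → φ t ≤ C * t ^ (p / 2))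
    (h2 : ∀ t : ℝ, 0 ≤ t → t ≤ 1 → φ t ≤ C * t ^ (q / 2)) {r : ℝ} (hr : 0 ≤ r) :
    φ (r ^ 2) ≤ C * (r ^ p + r ^ q) := by
  have key (a : ℝ) : (r ^ 2) ^ (a / 2) = r ^ a := by
    rw [← Real.rpow_natCast, ← Real.rpow_mul hr]
    congr 1
    push_cast
    ring
  have hp := Real.rpow_nonneg hr p
  have hq := Real.rpow_nonneg hr q
  rcases le_total 1 (r ^ 2) with h | h
  · exact (h1 _ h).trans (by rw [key]; gcongr; linarith)
  · exact (h2 _ (sq_nonneg r) h).trans (by rw [key]; gcongr; linarith)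

lemma eventually_rpow_combination_lt {a b c p q α s D : ℝ} (hp : p < s) (hq : q < s)
    (hα : α < s) (hD : 0 < D) :
    ∀ᶠ t : ℝ in atTop, a * t ^ p + b * t ^ q + c * t ^ α < D * t ^ s := by
  have lim {r : ℝ} (hr : r < s) : Tendsto (fun t : ℝ => t ^ (r - s)) atTop (𝓝 0) := by
    simpa using tendsto_rpow_neg_atTop (sub_pos.2 hr)
  have h : Tendsto (fun t : ℝ => a * t ^ (p - s) + b * t ^ (q - s) + c * t ^ (α - s))
      atTop (𝓝 0) := by
    simpa using (((lim hp).const_mul a).add ((lim hq).const_mul b)).add ((lim hα).const_mul c)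
  filter_upwards [h.eventually_lt_const hD, eventually_gt_atTop 0] with t ht ht0
  have hs := Real.rpow_pos_of_pos ht0 s
  rw [Real.rpow_sub ht0, Real.rpow_sub ht0, Real.rpow_sub ht0] at ht
  have := mul_lt_mul_of_pos_right ht hs
  field_simp at this
  linarith

lemma integral_abs_mul_rpow {X : Type*} [MeasurableSpace X] {μ : Measure X} (u : X → ℝ)
    {t : ℝ} (ht : 0 ≤ t) (r : ℝ) :
    ∫ x, |t * u x| ^ r ∂μ = t ^ r * ∫ x, |u x| ^ r ∂μ := by
  simp_rw [abs_mul, abs_of_nonneg ht, Real.mul_rpow ht (abs_nonneg _)]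
  exact integral_const_mul _ _

end NegativeForLargeT

/-- for every nonzero `u ∈ C_c^∞(ℝ^N)` there is `T > 0` such that
`I(t u) < 0` for all `t ≥ T`, where
`I(tu) = (1/2)∫φ(|t∇u|²) + (1/α)∫|t u|^α − (1/s)∫|t u|^s`. -/
theorem functional_negative_for_large_t {N : ℕ} (hN : 2 ≤ N) (p q α s : ℝ)
    (hp : 1 < p) (hpq : p < q) (hα : 1 < α) (hsq : q < s) (hsα : α < s)
    (φ : ℝ → ℝ) (hφcont : ContinuousOn φ (Ici 0))
    (C : ℝ) (hC : 0 < C)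
    (hφup1 : ∀ t : ℝ, 1 ≤ t → φ t ≤ C * t ^ (p / 2))
    (hφup2 : ∀ t : ℝ, 0 ≤ t → t ≤ 1 → φ t ≤ C * t ^ (q / 2))
    (u : EuclideanSpace ℝ (Fin N) → ℝ) (hu : ContDiff ℝ (⊤ : ℕ∞) u)
    (hsupp : HasCompactSupport u) (hne : u ≠ 0) :
    ∃ T : ℝ, 0 < T ∧ ∀ t : ℝ, T ≤ t →
      (1 / 2) * (∫ x, φ (‖t • gradient u x‖ ^ 2)) +
        (1 / α) * (∫ x, |t * u x| ^ α) - (1 / s) * (∫ x, |t * u x| ^ s) < 0 := by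
  have hs : 0 < s := by linarith
  have hgrad_cont : Continuous (gradient u) :=
    (InnerProductSpace.toDual ℝ (EuclideanSpace ℝ (Fin N))).symm.continuous.comp
      (hu.continuous_fderiv (by simp))
  have hgrad_supp : HasCompactSupport (gradient u) :=
    (hsupp.fderiv (𝕜 := ℝ)).comp_left
      (g := (InnerProductSpace.toDual ℝ (EuclideanSpace ℝ (Fin N))).symm) (map_zero _)
  have hint {r : ℝ} (hr : 0 < r) : Integrable (fun x => ‖gradient u x‖ ^ r) :=
    hgrad_supp.integrable_norm_rpow hgrad_cont hr
  have hD : 0 < ∫ x, |u x| ^ s := by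
    obtain ⟨x, hx⟩ := Function.ne_iff.1 hne
    refine Continuous.integral_pos_of_hasCompactSupport_nonneg_nonzero (x := x)
      (hu.continuous.abs.rpow_const fun _ => Or.inr hs.le)
      (hsupp.comp_left (g := fun y : ℝ => |y| ^ s) (by simp [hs.ne']))
      (fun x => Real.rpow_nonneg (abs_nonneg _) _) ?_
    exact (Real.rpow_pos_of_pos (abs_pos.2 hx) s).ne'
  have hφint {t : ℝ} (ht : 0 ≤ t) : ∫ x, φ (‖t • gradient u x‖ ^ 2) ≤
      C * (t ^ p * (∫ x, ‖gradient u x‖ ^ p) + t ^ q * ∫ x, ‖gradient u x‖ ^ q) := by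
    have hip := (hint (r := p) (by linarith)).const_mul (t ^ p)
    have hiq := (hint (r := q) (by linarith)).const_mul (t ^ q)
    rw [← integral_const_mul, ← integral_const_mul, ← integral_add hip hiq, ← integral_const_mul]
    refine integral_le_of_le_of_integrable_of_nonneg ((hip.add hiq).const_mul C)
      (fun x => by positivity) fun x => ?_
    rw [← Real.mul_rpow ht (norm_nonneg _), ← Real.mul_rpow ht (norm_nonneg _),
      norm_smul, Real.norm_of_nonneg ht]
    exact apply_sq_le_of_growth hC hφup1 hφup2 (by positivity)
  obtain ⟨T, hT⟩ := Filter.eventually_atTop.1 <| eventually_rpow_combination_lt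
    (a := 1 / 2 * C * ∫ x, ‖gradient u x‖ ^ p) (b := 1 / 2 * C * ∫ x, ‖gradient u x‖ ^ q)
    (c := 1 / α * ∫ x, |u x| ^ α) (hpq.trans hsq) hsq hsα (mul_pos (one_div_pos.2 hs) hD)
  refine ⟨max T 1, by positivity, fun t ht => ?_⟩
  have ht0 : 0 ≤ t := zero_le_one.trans ((le_max_right T 1).trans ht)
  rw [integral_abs_mul_rpow u ht0, integral_abs_mul_rpow u ht0]
  linarith [hφint ht0, hT t ((le_max_left T 1).trans ht)]
end
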